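/- (Local a posteriori error bound in the conserved quantities under Lipschitz continuity.) Under the stated hypotheses, the error in the conserved quantities satisfies ‖C̄ e^n‖ ≤ Σ_{ℓ=0}^k ε̄_ℓ κ ‖Z_Cᵀ e^{n−ℓ}‖ + Σ_{ℓ=1}^k γ̄_ℓ ‖C̄ e^{n−ℓ}‖; that is, the new contribution to the error in the conserved quantities at time instance n arises only from the component of the state-space error in the null space of the constraint matrix C̄. -/

import Mathlib

open Matrix Finset

noncomputable def euclNorm {n : ℕ} (v : Fin n → ℝ) : ℝ := Real.sqrt (∑ i, v i ^ 2)

noncomputable def matNorm {m n : ℕ} (M : Matrix (Fin m) (Fin n) ℝ) : ℝ :=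
  ‖LinearMap.toContinuousLinearMap (Matrix.toEuclideanLin M)‖

theorem euclNorm_eq_norm {n : ℕ} (v : Fin n → ℝ) : euclNorm v = ‖WithLp.toLp 2 v‖ := by
  simp [euclNorm, EuclideanSpace.norm_eq]

theorem euclNorm_add_le {n : ℕ} (v w : Fin n → ℝ) :
    euclNorm (v + w) ≤ euclNorm v + euclNorm w := by
  simpa [euclNorm_eq_norm] using norm_add_le (WithLp.toLp 2 v) (WithLp.toLp 2 w)

theorem euclNorm_sub_le {n : ℕ} (v w : Fin n → ℝ) :
    euclNorm (v - w) ≤ euclNorm v + euclNorm w := by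
  simpa [euclNorm_eq_norm] using norm_sub_le (WithLp.toLp 2 v) (WithLp.toLp 2 w)

theorem euclNorm_smul {n : ℕ} (a : ℝ) (v : Fin n → ℝ) :
    euclNorm (a • v) = |a| * euclNorm v := by
  simp [euclNorm_eq_norm, norm_smul]

theorem euclNorm_sum_le {n : ℕ} {ι : Type*} (s : Finset ι) (g : ι → Fin n → ℝ) :
    euclNorm (∑ i ∈ s, g i) ≤ ∑ i ∈ s, euclNorm (g i) := by
  simpa [euclNorm_eq_norm] using norm_sum_le s (fun i => WithLp.toLp 2 (g i))

theorem matNorm_nonneg {m n : ℕ} (M : Matrix (Fin m) (Fin n) ℝ) : 0 ≤ matNorm M :=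
  norm_nonneg _

theorem euclNorm_mulVec_le {m n : ℕ} (M : Matrix (Fin m) (Fin n) ℝ) (v : Fin n → ℝ) :
    euclNorm (M.mulVec v) ≤ matNorm M * euclNorm v := by
  simpa [euclNorm_eq_norm, matNorm] using
    (LinearMap.toContinuousLinearMap (Matrix.toEuclideanLin M)).le_opNorm (WithLp.toLp 2 v)

theorem euclNorm_mulVec_of_transpose_mul_self {m n : ℕ} {Q : Matrix (Fin m) (Fin n) ℝ}
    (hQ : Qᵀ * Q = 1) (v : Fin n → ℝ) : euclNorm (Q.mulVec v) = euclNorm v := by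
  have key : Q.mulVec v ⬝ᵥ Q.mulVec v = v ⬝ᵥ v := by
    rw [Matrix.dotProduct_mulVec, ← Matrix.mulVec_transpose, Matrix.mulVec_mulVec, hQ,
      Matrix.one_mulVec]
  simp only [dotProduct, ← pow_two] at key
  rw [euclNorm, euclNorm, key]

/-- A vector is controlled by its image under `C` and its component in the kernel of `C`. -/
theorem euclNorm_le_of_svd {m n r q : ℕ} {C : Matrix (Fin m) (Fin n) ℝ}
    {U : Matrix (Fin m) (Fin r) ℝ} {S : Matrix (Fin r) (Fin r) ℝ} {V : Matrix (Fin n) (Fin r) ℝ}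
    {Z : Matrix (Fin n) (Fin q) ℝ} (hU : Uᵀ * U = 1) (hdiag : ∀ i j, i ≠ j → S i j = 0)
    (hpos : ∀ i, 0 < S i i) (hC : C = U * S * Vᵀ) (hZ : Zᵀ * Z = 1)
    (hVZ : V * Vᵀ + Z * Zᵀ = 1) (v : Fin n → ℝ) :
    euclNorm v ≤ matNorm (V * S⁻¹ * Uᵀ) * euclNorm (C.mulVec v) + euclNorm (Zᵀ.mulVec v) := by
  have hS : S = Matrix.diagonal fun i => S i i := by
    ext i j
    by_cases h : i = j
    · simp [h]
    · simp [h, hdiag i j h]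
  have hdet : IsUnit S.det := by
    rw [hS, Matrix.det_diagonal]
    exact (Finset.prod_pos fun i _ => hpos i).ne'.isUnit
  have hproj : V * S⁻¹ * Uᵀ * C = V * Vᵀ := by
    calc V * S⁻¹ * Uᵀ * C = V * (S⁻¹ * (Uᵀ * U) * S) * Vᵀ := by simp only [hC, Matrix.mul_assoc]
      _ = V * Vᵀ := by rw [hU, Matrix.mul_one, Matrix.nonsing_inv_mul S hdet, Matrix.mul_one]
  have hv : v = (V * S⁻¹ * Uᵀ).mulVec (C.mulVec v) + Z.mulVec (Zᵀ.mulVec v) := by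
    rw [Matrix.mulVec_mulVec, Matrix.mulVec_mulVec, hproj, ← Matrix.add_mulVec, hVZ,
      Matrix.one_mulVec]
  calc euclNorm v
      = euclNorm ((V * S⁻¹ * Uᵀ).mulVec (C.mulVec v) + Z.mulVec (Zᵀ.mulVec v)) := by rw [← hv]
    _ ≤ _ := (euclNorm_add_le _ _).trans (add_le_add (euclNorm_mulVec_le _ _)
        (euclNorm_mulVec_of_transpose_mul_self hZ _).le)

/-- Local a posteriori error bound in the conserved quantities under Lipschitz
continuity: the new contribution to the error in the conserved quantities at
time instance `n` arises only from the component of the state-space error in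
the null space of the constraint matrix `C̄`. -/
theorem conserved_quantities_error_bound_lipschitz
    (N Nb p k : ℕ) (hN : 0 < N) (hNb : 0 < Nb) (hp : 0 < p) (hk : 1 ≤ k)
    (Φ : Matrix (Fin N) (Fin p) ℝ) (hΦ : Φᵀ * Φ = 1)
    (C : Matrix (Fin Nb) (Fin N) ℝ)
    (Δt : ℝ) (hΔt : 0 < Δt)
    (α β : ℕ → ℝ) (hα0 : α 0 ≠ 0)
    (t : ℕ → ℝ) (x0 : Fin N → ℝ)
    (f : (Fin N → ℝ) → ℝ → (Fin N → ℝ))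
    (κ : ℝ) (hκ : 0 < κ)
    (hLip : ∀ x y s, euclNorm (f x s - f y s) ≤ κ * euclNorm (x - y))
    (rC : ℕ) (hrC : rC = C.rank)
    (U : Matrix (Fin Nb) (Fin rC) ℝ) (Sc : Matrix (Fin rC) (Fin rC) ℝ)
    (V : Matrix (Fin N) (Fin rC) ℝ)
    (hU : Uᵀ * U = 1) (hV : Vᵀ * V = 1)
    (hSdiag : ∀ i j : Fin rC, i ≠ j → Sc i j = 0)
    (hSpos : ∀ i : Fin rC, 0 < Sc i i)
    (hSVD : C = U * Sc * Vᵀ)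
    (Cplus : Matrix (Fin N) (Fin Nb) ℝ) (hCplus : Cplus = V * Sc⁻¹ * Uᵀ)
    (κbar : ℝ) (hκbar : κbar = matNorm C * matNorm Cplus)
    (Z : Matrix (Fin N) (Fin (N - rC)) ℝ)
    (hZ : Zᵀ * Z = 1) (hZV : Zᵀ * V = 0)
    (hdecomp : V * Vᵀ + Z * Zᵀ = 1)
    (hstab : |β 0| * κ * κbar * Δt < |α 0|)
    (hbar : ℝ) (hhbar : hbar = |α 0| - |β 0| * κ * κbar * Δt)
    (εb γb : ℕ → ℝ)
    (hεb : ∀ ℓ, εb ℓ = |β ℓ| * matNorm C * Δt / hbar)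
    (hγb : ∀ ℓ, γb ℓ = (|α ℓ| + |β ℓ| * κ * κbar * Δt) / hbar)
    (rhat : (ℕ → Fin N → ℝ) → (Fin N → ℝ))
    (hrhat : ∀ y, rhat y = ∑ ℓ ∈ Finset.Icc 1 k,
      ((β ℓ * Δt) • f (x0 + y ℓ) (t ℓ) - α ℓ • y ℓ))
    (x : ℕ → Fin N → ℝ)
    (hFOM : α 0 • x 0 = (β 0 * Δt) • f (x0 + x 0) (t 0) + rhat x)
    (xh : ℕ → Fin p → ℝ)
    (hcons : α 0 • (C * Φ).mulVec (xh 0)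
      = (β 0 * Δt) • C.mulVec (f (x0 + Φ.mulVec (xh 0)) (t 0))
        + C.mulVec (rhat (fun ℓ => Φ.mulVec (xh ℓ))))
    (e : ℕ → Fin N → ℝ) (he : ∀ m, e m = x m - Φ.mulVec (xh m)) :
    euclNorm (C.mulVec (e 0)) ≤
      (∑ ℓ ∈ Finset.range (k + 1), εb ℓ * κ * euclNorm (Zᵀ.mulVec (e ℓ)))
      + ∑ ℓ ∈ Finset.Icc 1 k, γb ℓ * euclNorm (C.mulVec (e ℓ)) := by
  have hh : 0 < hbar := by linarith
  let d : ℕ → Fin N → ℝ := fun ℓ => f (x0 + x ℓ) (t ℓ) - f (x0 + Φ.mulVec (xh ℓ)) (t ℓ)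
  have hd : ∀ ℓ, euclNorm (C.mulVec (d ℓ)) ≤
      κ * κbar * euclNorm (C.mulVec (e ℓ)) + matNorm C * κ * euclNorm (Zᵀ.mulVec (e ℓ)) := by
    intro ℓ
    have hC := matNorm_nonneg C
    have h1 : euclNorm (d ℓ) ≤ κ * euclNorm (e ℓ) := by
      have h := hLip (x0 + x ℓ) (x0 + Φ.mulVec (xh ℓ)) (t ℓ)
      rwa [add_sub_add_left_eq_sub, ← he] at h
    have h2 := euclNorm_le_of_svd hU hSdiag hSpos hSVD hZ hdecomp (e ℓ)
    rw [← hCplus] at h2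
    calc euclNorm (C.mulVec (d ℓ)) ≤ matNorm C * euclNorm (d ℓ) := euclNorm_mulVec_le _ _
      _ ≤ matNorm C * (κ * (matNorm Cplus * euclNorm (C.mulVec (e ℓ))
            + euclNorm (Zᵀ.mulVec (e ℓ)))) := by
        gcongr
        exact h1.trans (by gcongr)
      _ = _ := by rw [hκbar]; ring
  have hdiff : α 0 • C.mulVec (e 0) = (β 0 * Δt) • C.mulVec (d 0)
      + ∑ ℓ ∈ Finset.Icc 1 k, ((β ℓ * Δt) • C.mulVec (d ℓ) - α ℓ • C.mulVec (e ℓ)) := by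
    have hr : rhat x - rhat (fun ℓ => Φ.mulVec (xh ℓ))
        = ∑ ℓ ∈ Finset.Icc 1 k, ((β ℓ * Δt) • d ℓ - α ℓ • e ℓ) := by
      rw [hrhat, hrhat, ← Finset.sum_sub_distrib]
      refine Finset.sum_congr rfl fun ℓ _ => ?_
      simp only [d, he, smul_sub]
      abel
    have hsum : C.mulVec (rhat x) - C.mulVec (rhat fun ℓ => Φ.mulVec (xh ℓ))
        = ∑ ℓ ∈ Finset.Icc 1 k, ((β ℓ * Δt) • C.mulVec (d ℓ) - α ℓ • C.mulVec (e ℓ)) := by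
      rw [← Matrix.mulVec_sub, hr, Matrix.mulVec_sum]
      simp only [Matrix.mulVec_sub, Matrix.mulVec_smul]
    have hx := congrArg C.mulVec hFOM
    rw [Matrix.mulVec_add, Matrix.mulVec_smul, Matrix.mulVec_smul] at hx
    rw [← hsum, he, Matrix.mulVec_sub, smul_sub, Matrix.mulVec_mulVec, hcons, hx]
    simp only [d, Matrix.mulVec_sub, smul_sub]
    abel
  have hterm : ∀ ℓ, |β ℓ * Δt| * euclNorm (C.mulVec (d ℓ)) ≤
      |β ℓ| * κ * κbar * Δt * euclNorm (C.mulVec (e ℓ))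
        + hbar * (εb ℓ * κ * euclNorm (Zᵀ.mulVec (e ℓ))) := by
    intro ℓ
    rw [abs_mul, abs_of_pos hΔt, hεb]
    calc |β ℓ| * Δt * euclNorm (C.mulVec (d ℓ))
        ≤ |β ℓ| * Δt * (κ * κbar * euclNorm (C.mulVec (e ℓ))
            + matNorm C * κ * euclNorm (Zᵀ.mulVec (e ℓ))) :=
          mul_le_mul_of_nonneg_left (hd ℓ) (by positivity)
      _ = _ := by field_simp
  have hpast : ∀ ℓ, euclNorm ((β ℓ * Δt) • C.mulVec (d ℓ) - α ℓ • C.mulVec (e ℓ)) ≤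
      hbar * (εb ℓ * κ * euclNorm (Zᵀ.mulVec (e ℓ)))
        + hbar * (γb ℓ * euclNorm (C.mulVec (e ℓ))) := by
    intro ℓ
    have hγ : hbar * (γb ℓ * euclNorm (C.mulVec (e ℓ)))
        = (|α ℓ| + |β ℓ| * κ * κbar * Δt) * euclNorm (C.mulVec (e ℓ)) := by
      rw [hγb]
      field_simp
    have h := euclNorm_sub_le ((β ℓ * Δt) • C.mulVec (d ℓ)) (α ℓ • C.mulVec (e ℓ))
    rw [euclNorm_smul, euclNorm_smul] at h
    linarith [hterm ℓ]
  have hmain : |α 0| * euclNorm (C.mulVec (e 0)) ≤ |β 0 * Δt| * euclNorm (C.mulVec (d 0))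
      + ∑ ℓ ∈ Finset.Icc 1 k, (hbar * (εb ℓ * κ * euclNorm (Zᵀ.mulVec (e ℓ)))
        + hbar * (γb ℓ * euclNorm (C.mulVec (e ℓ)))) := by
    rw [← euclNorm_smul, ← euclNorm_smul, hdiff]
    refine (euclNorm_add_le _ _).trans ?_
    gcongr
    exact (euclNorm_sum_le _ _).trans (Finset.sum_le_sum fun ℓ _ => hpast ℓ)
  rw [Finset.sum_add_distrib, ← Finset.mul_sum, ← Finset.mul_sum] at hmain
  have hrange : Finset.Icc 1 k = Finset.Ico (0 + 1) (k + 1) := by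
    ext ℓ
    simp only [Finset.mem_Icc, Finset.mem_Ico]
    omega
  rw [Finset.range_eq_Ico, Finset.sum_eq_sum_Ico_succ_bot k.succ_pos, ← hrange]
  refine le_of_mul_le_mul_left ?_ hh
  have h0 := hterm 0
  have hexp : hbar * euclNorm (C.mulVec (e 0)) = |α 0| * euclNorm (C.mulVec (e 0))
      - |β 0| * κ * κbar * Δt * euclNorm (C.mulVec (e 0)) := by
    rw [hhbar]
    ring
  rw [mul_add, mul_add]
  linarith
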